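/- arXiv:2204.04556 — 2 statements merged into one kernel-verified Lean document; each statement's English description precedes it below -/
import Mathlib

section
/- Let S be an ℕ-graded commutative ring and let M be a ℤ-graded S-module whose grading is left-bounded (M_{-N} = 0 for N ≫ 0) and such that M_n is a finitely generated S_0-module for every n ∈ ℤ. Then M is a finitely generated S-module if and only if the quotient M / S_{>0} M is right bounded, i.e. (M / S_{>0} M)_n = 0 for all n ≫ 0. -/
/-!
Setting: `S` is an ℕ-graded commutative ring.  We realize this as: `S` is a commutative ring,
`R` is a commutative ring mapping isomorphically onto the degree-zero part `S_0` of `S`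
(hypotheses `h0S`, `hinjS` below), and `𝒮 : ℕ → Submodule R S` is the grading.
`M` is a ℤ-graded `S`-module with grading `ℳ : ℤ → Submodule R M` (each graded piece is an
`S_0`-submodule), with `S_m • M_n ⊆ M_{m+n}`.

STATEMENT 6: if the grading of `M` is left-bounded (`M_n = 0` for `n ≪ 0`) and every graded
piece `M_n` is a finitely generated `S_0`-module, then `M` is a finitely generated `S`-module
if and only if `M / S_{>0} M` is right bounded, i.e. its degree-`n` piece (the image of `M_n`)
vanishes for all `n ≫ 0`, i.e. `M_n ⊆ S_{>0} M` for all `n ≫ 0`.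
-/

noncomputable section

/-- The irrelevant ideal `S_{>0} = ⊕_{n>0} S_n` of an ℕ-graded ring: the ideal generated by
the homogeneous elements of positive degree. -/
def irrIdeal {R S : Type*} [CommRing R] [CommRing S] [Algebra R S]
    (𝒮 : ℕ → Submodule R S) : Ideal S :=
  Ideal.span {s : S | ∃ n, 0 < n ∧ s ∈ 𝒮 n}

section GradedPieces

variable {R S M : Type*} [CommRing R] [CommRing S] [Algebra R S]
  (𝒮 : ℕ → Submodule R S) [AddCommGroup M] [Module S M]

theorem homogeneous_smul_mem_irrIdeal_smul_top {d : ℕ} (hd : 0 < d) {s : S} (hs : s ∈ 𝒮 d)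
    (x : M) : s • x ∈ irrIdeal 𝒮 • (⊤ : Submodule S M) :=
  Submodule.smul_mem_smul (Ideal.subset_span ⟨d, hd, hs⟩) trivial

/-- An additive subgroup stable under multiplication by homogeneous elements is stable under
multiplication by all elements of the graded ring. -/
theorem smul_mem_of_homogeneous_smul_mem [GradedAlgebra 𝒮] {Q : AddSubgroup M}
    (hQ : ∀ d, ∀ s ∈ 𝒮 d, ∀ x ∈ Q, s • x ∈ Q) (s : S) {x : M} (hx : x ∈ Q) : s • x ∈ Q := by
  induction s using DirectSum.Decomposition.inductionOn 𝒮 with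
  | zero => simp
  | @homogeneous k m => exact hQ k m m.2 x hx
  | add a b ha hb => rw [add_smul]; exact Q.add_mem ha hb

variable [Module R M] (ℳ : ℤ → Submodule R M) [DirectSum.Decomposition ℳ]

/-- The degree-`n` component of `s • x`, for `s` homogeneous of degree `d`, is `s` times the
degree-`(n - d)` component of `x`. -/
theorem decompose_homogeneous_smul
    (hsmul : ∀ (m : ℕ) (n : ℤ), ∀ s ∈ 𝒮 m, ∀ x ∈ ℳ n, s • x ∈ ℳ (m + n))
    {d : ℕ} {s : S} (hs : s ∈ 𝒮 d) (x : M) (n : ℤ) :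
    (DirectSum.decompose ℳ (s • x) n : M) = s • (DirectSum.decompose ℳ x (n - d) : M) := by
  induction x using DirectSum.Decomposition.inductionOn ℳ with
  | zero => simp
  | @homogeneous k m =>
    have hm := hsmul d k s hs m m.2
    by_cases h : (d : ℤ) + k = n
    · subst h
      rw [DirectSum.decompose_of_mem_same ℳ hm, add_sub_cancel_left,
        DirectSum.decompose_of_mem_same ℳ m.2]
    · rw [DirectSum.decompose_of_mem_ne ℳ hm h,
        DirectSum.decompose_of_mem_ne ℳ m.2 (by omega), smul_zero]
  | add x y hx hy =>
    simp only [smul_add, DirectSum.decompose_add, DirectSum.add_apply, Submodule.coe_add, hx, hy]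

variable [GradedAlgebra 𝒮]

/-- The elements whose components in all degrees of a set `D` lie in a submodule `P`, as a
submodule, provided that multiplication by homogeneous elements preserves this condition. -/
def componentsIn (P : Submodule S M) (D : Set ℤ)
    (h : ∀ d, ∀ s ∈ 𝒮 d, ∀ x : M, (∀ n ∈ D, (DirectSum.decompose ℳ x n : M) ∈ P) →
      ∀ n ∈ D, (DirectSum.decompose ℳ (s • x) n : M) ∈ P) : Submodule S M :=
  let Q : AddSubgroup M :=
    { carrier := {x | ∀ n ∈ D, (DirectSum.decompose ℳ x n : M) ∈ P}
      zero_mem' := fun n _ => by simp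
      add_mem' := fun {x y} hx hy n hn => by
        simpa only [DirectSum.decompose_add, DirectSum.add_apply, Submodule.coe_add] using
          P.add_mem (hx n hn) (hy n hn)
      neg_mem' := fun {x} hx n hn => by
        have hneg : (DirectSum.decompose ℳ (-x) n : M) = -(DirectSum.decompose ℳ x n : M) := by
          rw [DirectSum.decompose_neg]; rfl
        rw [hneg]
        exact P.neg_mem (hx n hn) }
  { Q with smul_mem' := fun s _ hx => smul_mem_of_homogeneous_smul_mem 𝒮 (Q := Q) h s hx }

theorem mem_componentsIn {P : Submodule S M} {D : Set ℤ}
    {h : ∀ d, ∀ s ∈ 𝒮 d, ∀ x : M, (∀ n ∈ D, (DirectSum.decompose ℳ x n : M) ∈ P) →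
      ∀ n ∈ D, (DirectSum.decompose ℳ (s • x) n : M) ∈ P} {x : M} :
    x ∈ componentsIn 𝒮 ℳ P D h ↔ ∀ n ∈ D, (DirectSum.decompose ℳ x n : M) ∈ P :=
  Iff.rfl

/-- Above the degrees of a finite generating set, every homogeneous element lies in
`S_{>0} M`. -/
theorem exists_forall_ge_subset_irrIdeal_smul_top
    (hsmul : ∀ (m : ℕ) (n : ℤ), ∀ s ∈ 𝒮 m, ∀ x ∈ ℳ n, s • x ∈ ℳ (m + n))
    (hM : Module.Finite S M) :
    ∃ N : ℤ, ∀ n ≥ N,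
      (ℳ n : Set M) ⊆ ↑(irrIdeal 𝒮 • (⊤ : Submodule S M) : Submodule S M) := by
  classical
  obtain ⟨T, hT⟩ := hM.fg_top
  obtain ⟨N, hN⟩ := (T.biUnion fun t => (DirectSum.decompose ℳ t).support).bddAbove
  refine ⟨N + 1, fun n hn x hx => ?_⟩
  have htop : ⊤ ≤ componentsIn 𝒮 ℳ (irrIdeal 𝒮 • ⊤) (Set.Ici (N + 1)) (by
      intro d s hs x hx n hn
      rw [decompose_homogeneous_smul 𝒮 ℳ hsmul hs]
      rcases Nat.eq_zero_or_pos d with rfl | hd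
      · exact Submodule.smul_mem _ s (hx _ (by simpa using hn))
      · exact homogeneous_smul_mem_irrIdeal_smul_top 𝒮 hd hs _) := by
    refine hT.ge.trans (Submodule.span_le.2 ?_)
    intro t ht n hn
    have hzero : DirectSum.decompose ℳ t n = 0 := by
      by_contra h
      have := hN (Finset.mem_coe.2 (Finset.mem_biUnion.2 ⟨t, ht, DFinsupp.mem_support_iff.2 h⟩))
      have := Set.mem_Ici.1 hn
      omega
    rw [hzero]
    exact Submodule.zero_mem _
  have hxn := (mem_componentsIn 𝒮 ℳ).1 (htop (Submodule.mem_top (x := x))) n hn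
  rwa [DirectSum.decompose_of_mem_same ℳ hx] at hxn

/-- If a submodule `P` contains all pieces of degree less than `n`, then it contains every
element of degree `n` lying in `S_{>0} M`. -/
theorem mem_of_mem_irrIdeal_smul_top
    (hsmul : ∀ (m : ℕ) (n : ℤ), ∀ s ∈ 𝒮 m, ∀ x ∈ ℳ n, s • x ∈ ℳ (m + n))
    {P : Submodule S M} {n : ℤ} (hP : ∀ k < n, ∀ x ∈ ℳ k, x ∈ P) {x : M} (hx : x ∈ ℳ n)
    (hxI : x ∈ irrIdeal 𝒮 • (⊤ : Submodule S M)) : x ∈ P := by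
  have hle : irrIdeal 𝒮 • ⊤ ≤ componentsIn 𝒮 ℳ P (Set.Iic n) (by
      intro d s hs x hx k hk
      rw [decompose_homogeneous_smul 𝒮 ℳ hsmul hs]
      have := Set.mem_Iic.1 hk
      exact P.smul_mem s (hx _ (Set.mem_Iic.2 (by omega)))) := by
    rw [irrIdeal, Submodule.span_smul_eq, Submodule.set_smul_le_iff]
    rintro s m ⟨d, hd, hs⟩ - k hk
    rw [decompose_homogeneous_smul 𝒮 ℳ hsmul hs]
    have := Set.mem_Iic.1 hk
    exact P.smul_mem s (hP _ (by omega) _ (SetLike.coe_mem _))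
  have hxn := (mem_componentsIn 𝒮 ℳ).1 (hle hxI) n Set.self_mem_Iic
  rwa [DirectSum.decompose_of_mem_same ℳ hx] at hxn

/-- A left-bounded graded module with finite pieces is finite if `M / S_{>0} M` is right
bounded. -/
theorem finite_of_forall_ge_subset_irrIdeal_smul_top [IsScalarTower R S M]
    (hsmul : ∀ (m : ℕ) (n : ℤ), ∀ s ∈ 𝒮 m, ∀ x ∈ ℳ n, s • x ∈ ℳ (m + n))
    {B : ℤ} (hB : ∀ n < B, ℳ n = ⊥) (hfg : ∀ n : ℤ, Module.Finite R ↥(ℳ n))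
    {N : ℤ} (hN : ∀ n ≥ N,
      (ℳ n : Set M) ⊆ ↑(irrIdeal 𝒮 • (⊤ : Submodule S M) : Submodule S M)) :
    Module.Finite S M := by
  set P : Submodule S M := ⨆ n ∈ Finset.Ico B N, Submodule.span S (ℳ n : Set M) with hPdef
  have hPfg : P.FG := by
    refine Submodule.fg_biSup _ _ fun n _ => ?_
    obtain ⟨T, hT⟩ := Module.Finite.iff_fg.1 (hfg n)
    exact ⟨T, by rw [← hT, Submodule.span_span_of_tower]⟩
  have hbelow : ∀ n < B, ∀ x ∈ ℳ n, x ∈ P := by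
    intro n hn x hx
    rw [hB n hn, Submodule.mem_bot] at hx
    exact hx ▸ P.zero_mem
  have hall : ∀ (j : ℕ) (n : ℤ), n < B + j → ∀ x ∈ ℳ n, x ∈ P := by
    intro j
    induction j with
    | zero => exact fun n hn => hbelow n (by simpa using hn)
    | succ j ih =>
      intro n hn x hx
      rcases lt_or_ge n B with hnB | hnB
      · exact hbelow n hnB x hx
      rcases lt_or_ge n N with hnN | hnN
      · exact (le_iSup₂_of_le (f := fun n (_ : n ∈ Finset.Ico B N) =>
          Submodule.span S (ℳ n : Set M)) n (Finset.mem_Ico.2 ⟨hnB, hnN⟩) le_rfl)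
          (Submodule.subset_span hx)
      · exact mem_of_mem_irrIdeal_smul_top 𝒮 ℳ hsmul
          (fun k hk => ih k (by push_cast at hn; omega)) hx (hN n hnN hx)
  have hPtop : P = ⊤ := by
    refine eq_top_iff.2 fun x _ => ?_
    induction x using DirectSum.Decomposition.inductionOn ℳ with
    | zero => exact P.zero_mem
    | @homogeneous n m => exact hall (n - B + 1).toNat n (by omega) m m.2
    | add x y hx hy => exact P.add_mem (hx trivial) (hy trivial)
  exact ⟨hPtop ▸ hPfg⟩

end GradedPieces

/-- graded Nakayama: for a ℤ-graded module `M` over an ℕ-graded commutative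
ring `S`, left-bounded and with finitely generated graded pieces over `S_0`, `M` is a finitely
generated `S`-module iff `M/S_{>0}M` is right bounded (equivalently, `M_n ⊆ S_{>0}M` for all
`n ≫ 0`). -/
theorem finite_iff_right_bounded {R S M : Type*} [CommRing R] [CommRing S] [Algebra R S]
    (𝒮 : ℕ → Submodule R S) [GradedAlgebra 𝒮]
    (h0S : ∀ s ∈ 𝒮 0, ∃ r : R, algebraMap R S r = s)
    (hinjS : Function.Injective (algebraMap R S))
    [AddCommGroup M] [Module S M] [Module R M] [IsScalarTower R S M]
    (ℳ : ℤ → Submodule R M) [DirectSum.Decomposition ℳ]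
    (hsmul : ∀ (m : ℕ) (n : ℤ), ∀ s ∈ 𝒮 m, ∀ x ∈ ℳ n, s • x ∈ ℳ (m + n))
    (hlb : ∃ B : ℤ, ∀ n < B, ℳ n = ⊥)
    (hfg : ∀ n : ℤ, Module.Finite R ↥(ℳ n)) :
    Module.Finite S M ↔
      ∃ N : ℤ, ∀ n ≥ N,
        (ℳ n : Set M) ⊆ ↑(irrIdeal 𝒮 • (⊤ : Submodule S M) : Submodule S M) := by
  refine ⟨exists_forall_ge_subset_irrIdeal_smul_top 𝒮 ℳ hsmul, ?_⟩
  rintro ⟨N, hN⟩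
  obtain ⟨B, hB⟩ := hlb
  exact finite_of_forall_ge_subset_irrIdeal_smul_top 𝒮 ℳ hsmul hB hfg hN

end
end

section
/- With S_0 = ℂ[α_1,…,α_d] localized at the principal A-determinant E_A, S = S_0[y_1,…,y_k], T = S_0[x^{a_1},…,x^{a_d}], and γ : S → T the S_0-algebra map y_i ↦ x_i ∂f/∂x_i where f = Σ_i α_i x^{a_i}: the map γ is injective. Indeed, S and T are integral domains of equal Krull dimension (using that the a_i span ℝ^k), and the induced morphism Spec T → Spec S is finite, hence dominant onto an irreducible scheme of the same dimension. -/
/-!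
Setting: `d > n` positive integers, `k = d - n`, `A = {a_1, …, a_d} ⊂ ℤ^k` spanning `ℝ^k`,
with each `a_i = (a_i', 1)`.  `P ⊂ ℝ^{k-1}` is the convex hull of the `a_i'`; a face `F` of `P`
is identified with `{i : a_i' ∈ F}`, equivalently `F` is cut out by an integral linear functional
`λ` with `⟨λ, a_i⟩ = 0` for `i ∈ F` and `⟨λ, a_i⟩ > 0` for `i ∉ F`.

STATEMENT 13: with `S₀ = ℂ[α_1,…,α_d]` localized at the principal `A`-determinant `E_A`
(a polynomial whose zero locus is the union, over the faces `F` of `P` whose discriminant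
closure is a hypersurface, of the preimages of those closures), `S = S₀[y_1,…,y_k]`,
`T = S₀[x^{a_1},…,x^{a_d}]`, and `γ : S → T` the `S₀`-algebra map `y_l ↦ x_l ∂f/∂x_l` for
`f = ∑_i α_i x^{a_i}`: the map `γ` is injective.
-/

open MvPolynomial

set_option synthInstance.maxHeartbeats 1000000
set_option maxHeartbeats 1000000

noncomputable section

/-- The monomial value `u ^ a = u₁^{a₁} ⋯ u_k^{a_k}` for `u` in the torus `(ℂ*)^k`. -/
def torusMonomial {k : ℕ} (a : Fin k → ℤ) (u : Fin k → ℂˣ) : ℂ :=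
  ((∏ j, u j ^ a j : ℂˣ) : ℂ)

/-- `F ⊆ {1,…,d}` is (the index set of) a nonempty face of `P = conv(a_1', …, a_d')`:
there is an integral linear functional vanishing on the `a_i`, `i ∈ F`, and strictly positive
on the `a_i`, `i ∉ F`. -/
def IsFaceOf {d k : ℕ} (A : Fin d → Fin k → ℤ) (F : Finset (Fin d)) : Prop :=
  F.Nonempty ∧ ∃ lam : Fin k → ℤ,
    (∀ i ∈ F, ∑ j, lam j * A i j = 0) ∧ ∀ i ∉ F, 0 < ∑ j, lam j * A i j

/-- The discriminant locus `∇_F ⊆ ℂ^F` of `f^F = ∑_{i ∈ F} α_i x^{a_i}`: the set of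
coefficient vectors `α` such that all the partial derivatives `∂ f^F/∂ x_l` (equivalently all
the `x_l ∂ f^F/∂ x_l = ∑_{i ∈ F} α_i (a_i)_l x^{a_i}`) vanish simultaneously at some point `u`
of the torus `(ℂ*)^k`. -/
def nabla {d k : ℕ} (A : Fin d → Fin k → ℤ) (F : Finset (Fin d)) : Set (F → ℂ) :=
  {α | ∃ u : Fin k → ℂˣ, ∀ l : Fin k,
    ∑ i : F, α i * (A i l : ℂ) * torusMonomial (A i) u = 0}

/-- The coordinate projection `p_F : ℂ^A → ℂ^F`. -/
def pProj {d : ℕ} (F : Finset (Fin d)) : (Fin d → ℂ) → (F → ℂ) := fun α i => α i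

/-- `V(A) = ⋃_F p_F⁻¹(∇_F)`, the union over all faces `F` of `P`. -/
def VA {d k : ℕ} (A : Fin d → Fin k → ℤ) : Set (Fin d → ℂ) :=
  ⋃ F ∈ {F : Finset (Fin d) | IsFaceOf A F}, pProj F ⁻¹' nabla A F

/-- The Zariski closure of a subset of affine space `ℂ^σ`: the common zero locus of all
polynomials vanishing on the set. -/
def zClosure {σ : Type*} (s : Set (σ → ℂ)) : Set (σ → ℂ) :=
  {x | ∀ p : MvPolynomial σ ℂ, (∀ y ∈ s, eval y p = 0) → eval x p = 0}

/-- A subset of `ℂ^σ` is a hypersurface if it is the zero locus of a single nontrivial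
polynomial equation. -/
def IsHypersurface {σ : Type*} (s : Set (σ → ℂ)) : Prop :=
  ∃ Δ : MvPolynomial σ ℂ, Δ ≠ 0 ∧ ¬ IsUnit Δ ∧ s = {x | eval x Δ = 0}

/-- The zero locus `V(E_A)` of the principal `A`-determinant `E_A = ∏_F Δ_F^{m_F}`: the union,
over the faces `F` of `P` whose discriminant closure is a hypersurface in `ℂ^F`, of the
preimages under `p_F` of those hypersurfaces `closure(∇_F)`. -/
def VEA {d k : ℕ} (A : Fin d → Fin k → ℤ) : Set (Fin d → ℂ) :=
  ⋃ F ∈ {F : Finset (Fin d) | IsFaceOf A F ∧ IsHypersurface (zClosure (nabla A F))},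
    pProj F ⁻¹' zClosure (nabla A F)

/-- The ring `T = S₀[x^{a_1},…,x^{a_d}]`, the subalgebra of the Laurent polynomial ring
`S₀[x_1^{±1},…,x_k^{±1}] = S₀[ℤ^k]` generated by the monomials `x^{a_i}`, where
`S₀ = ℂ[α_1,…,α_d]_{E}` is the localization of `ℂ[α_1,…,α_d]` at `E`. -/
def Tring {d k : ℕ} (A : Fin d → Fin k → ℤ) (E : MvPolynomial (Fin d) ℂ) :
    Subalgebra (Localization.Away E) (AddMonoidAlgebra (Localization.Away E) (Fin k → ℤ)) :=
  Algebra.adjoin _ (Set.range fun i => AddMonoidAlgebra.of' _ (Fin k → ℤ) (A i))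

/-- The image in `S₀ = ℂ[α_1,…,α_d]_{E}` of the variable `α_i`. -/
def alphaBar {d : ℕ} (E : MvPolynomial (Fin d) ℂ) (i : Fin d) : Localization.Away E :=
  algebraMap (MvPolynomial (Fin d) ℂ) (Localization.Away E) (X i)

/-- The element `x_l ∂f/∂x_l = ∑_i α_i (a_i)_l x^{a_i}` of `T`, for `f = ∑_i α_i x^{a_i}`. -/
def gElemLoc {d k : ℕ} (A : Fin d → Fin k → ℤ) (E : MvPolynomial (Fin d) ℂ) (l : Fin k) :
    ↥(Tring A E) :=
  ⟨∑ i, (alphaBar E i * ((A i l : ℤ) : Localization.Away E)) •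
      AddMonoidAlgebra.of' _ (Fin k → ℤ) (A i),
    Subalgebra.sum_mem _ fun i _ =>
      Subalgebra.smul_mem _ (Algebra.subset_adjoin (Set.mem_range_self i)) _⟩

/-- The chain rule for a derivation applied to a polynomial expression. -/
theorem Derivation.map_mvPolynomial_aeval {R B ι : Type*} [CommRing R] [CommRing B] [Algebra R B]
    [Fintype ι] (D : Derivation R B B) (g : ι → B) (p : MvPolynomial ι R) :
    D (aeval g p) = ∑ l, aeval g (pderiv l p) * D (g l) := by
  classical
  induction p using MvPolynomial.induction_on with
  | C a => simp
  | add p q hp hq => simp [hp, hq, add_mul, Finset.sum_add_distrib]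
  | mul_X p i hp =>
    simp only [map_mul, aeval_X, Derivation.leibniz, hp, smul_eq_mul, map_add, pderiv_X,
      add_mul, Finset.sum_add_distrib, Finset.mul_sum]
    congr 1
    · rw [Finset.sum_eq_single i] <;> simp +contextual [eq_comm]
    · exact Finset.sum_congr rfl fun l _ => by ring

/-- The Jacobian criterion in characteristic zero: elements with nonvanishing Jacobian determinant
with respect to some derivations are algebraically independent. -/
theorem algebraicIndependent_of_det_derivation_ne_zero {R B ι : Type*} [CommRing R] [IsDomain R]
    [CharZero R] [CommRing B] [IsDomain B] [Algebra R B] [FaithfulSMul R B]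
    [Fintype ι] [DecidableEq ι] (D : ι → Derivation R B B) (g : ι → B)
    (hdet : (Matrix.of fun m l => D m (g l)).det ≠ 0) :
    AlgebraicIndependent R g := by
  have key : ∀ N : ℕ, ∀ p : MvPolynomial ι R, (∀ m, N ≤ m.degree → coeff m p = 0) →
      aeval g p = 0 → p = 0 := by
    intro N
    induction N with
    | zero => exact fun p hp _ => MvPolynomial.ext _ _ fun m => by simpa using hp m (Nat.zero_le _)
    | succ N ih =>
      intro p hp h0
      have hker : ∀ l, aeval g (pderiv l p) = 0 := by
        refine congrFun (Matrix.eq_zero_of_mulVec_eq_zero hdet (funext fun m => ?_))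
        have h := (D m).map_mvPolynomial_aeval g p
        rw [h0, map_zero] at h
        simpa [Matrix.mulVec, dotProduct, mul_comm] using h.symm
      have hpd : ∀ l, pderiv l p = 0 := fun l => ih _ (fun m hm => by
        rw [coeff_pderiv, hp _ (by simpa using hm), zero_mul]) (hker l)
      have hC : p = C (coeff 0 p) := by
        refine MvPolynomial.ext _ _ fun m => ?_
        by_cases hm : m = 0
        · simp [hm]
        · obtain ⟨l, hl⟩ := Finsupp.ne_iff.1 hm
          have h := coeff_pderiv (i := l) p (m - Finsupp.single l 1)
          have hle : Finsupp.single l 1 ≤ m :=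
            Finsupp.single_le_iff.2 (Nat.one_le_iff_ne_zero.2 hl)
          rw [hpd, coeff_zero, tsub_add_cancel_of_le hle] at h
          rw [coeff_C, if_neg (Ne.symm hm)]
          exact (mul_eq_zero.1 h.symm).resolve_right (Nat.cast_add_one_ne_zero _)
      rw [hC, aeval_C, FaithfulSMul.algebraMap_eq_zero_iff] at h0
      rw [hC, h0, C_0]
  refine (injective_iff_map_eq_zero _).2 fun p hp => key (p.totalDegree + 1) p (fun m hm => ?_) hp
  exact coeff_eq_zero_of_totalDegree_lt (Nat.lt_of_succ_le hm)

/-- The derivation of `R[M]` multiplying the monomial `x ^ m` by the scalar `φ m`. -/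
def AddMonoidAlgebra.weightDerivation {R M : Type*} [CommRing R] [AddCommMonoid M] (φ : M →+ R) :
    Derivation R (AddMonoidAlgebra R M) (AddMonoidAlgebra R M) :=
  Derivation.mk' ((AddMonoidAlgebra.coeffLinearEquiv R).symm.toLinearMap ∘ₗ
      Finsupp.lsum R (fun m => Finsupp.lsingle m ∘ₗ LinearMap.mulLeft R (φ m)) ∘ₗ
      (AddMonoidAlgebra.coeffLinearEquiv R).toLinearMap) <| by
    intro a b
    induction a using AddMonoidAlgebra.induction_linear with
    | zero => simp
    | add a a' h h' => simp only [add_mul, map_add, h, h', smul_eq_mul, mul_add]; ring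
    | single m r =>
      induction b using AddMonoidAlgebra.induction_linear with
      | zero => simp
      | add b b' h h' => simp only [add_mul, map_add, h, h', smul_eq_mul, mul_add]; ring
      | single m' r' =>
        have hcomm : m' + m = m + m' := add_comm _ _
        simp only [AddMonoidAlgebra.single_mul_single, LinearMap.comp_apply,
          LinearEquiv.coe_coe, AddMonoidAlgebra.coeffLinearEquiv_apply,
          AddMonoidAlgebra.coeff_single, Finsupp.lsum_single, LinearMap.mulLeft_apply,
          Finsupp.lsingle_apply, AddMonoidAlgebra.coeffLinearEquiv_symm_apply,
          AddMonoidAlgebra.ofCoeff_single, smul_eq_mul, hcomm, map_add,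
          ← AddMonoidAlgebra.single_add]
        congr 1
        ring

@[simp]
theorem AddMonoidAlgebra.weightDerivation_single {R M : Type*} [CommRing R] [AddCommMonoid M]
    (φ : M →+ R) (m : M) (r : R) :
    weightDerivation φ (single m r) = single m (φ m * r) := by
  simp [weightDerivation, -Finsupp.single_mul]

/-- The matrix with entries `x_m ∂/∂x_m (x_l ∂f/∂x_l)` for `f = ∑_i c_i x^{a_i}`. -/
def logHessian {R : Type*} [CommRing R] {d k : ℕ} (A : Fin d → Fin k → ℤ) (c : Fin d → R) :
    Matrix (Fin k) (Fin k) (AddMonoidAlgebra R (Fin k → ℤ)) :=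
  Matrix.of fun m l => ∑ i, AddMonoidAlgebra.single (A i) ((A i m : R) * (c i * (A i l : R)))

theorem det_transpose_mul_self_ne_zero {ι κ : Type*} [Fintype ι] [Fintype κ] [DecidableEq κ]
    (A : Matrix ι κ ℝ) (hspan : Submodule.span ℝ (Set.range A) = ⊤) :
    (A.transpose * A).det ≠ 0 := by
  have hinj : Function.Injective A.mulVec := by
    refine (injective_iff_map_eq_zero A.mulVecLin).2 fun v hv => ?_
    have hle : (⊤ : Submodule ℝ (κ → ℝ)) ≤ LinearMap.ker (dotProductBilin ℝ ℝ v) := by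
      rw [← hspan, Submodule.span_le]
      rintro _ ⟨i, rfl⟩
      have := congrFun hv i
      simpa [Matrix.mulVec, dotProduct_comm] using this
    have := hle (Submodule.mem_top (x := v))
    exact dotProduct_self_eq_zero.1 (by simpa using this)
  have := (Matrix.PosDef.conjTranspose_mul_self A hinj).det_pos.ne'
  rwa [Matrix.conjTranspose_eq_transpose_of_trivial] at this

theorem logHessian_map {R S : Type*} [CommRing R] [CommRing S] (f : R →+* S) {d k : ℕ}
    (A : Fin d → Fin k → ℤ) (c : Fin d → R) :
    (AddMonoidAlgebra.mapRingHom _ f).mapMatrix (logHessian A c) =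
      logHessian A fun i => f (c i) := by
  ext1 m l
  simp [logHessian]

theorem det_logHessian_X_ne_zero {d k : ℕ} (A : Fin d → Fin k → ℤ)
    (hspan : Submodule.span ℝ (Set.range fun i => fun j => (A i j : ℝ)) = ⊤) :
    (logHessian A (X : Fin d → MvPolynomial (Fin d) ℂ)).det ≠ 0 := by
  intro h
  let Φ : AddMonoidAlgebra (MvPolynomial (Fin d) ℂ) (Fin k → ℤ) →+* ℂ :=
    AddMonoidAlgebra.liftNCRingHom (eval fun _ => (1 : ℂ)) 1 fun _ _ => Commute.all _ _
  let M : Matrix (Fin d) (Fin k) ℝ := fun i j => (A i j : ℝ)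
  have hM : Φ.mapMatrix (logHessian A X) = Complex.ofRealHom.mapMatrix (M.transpose * M) := by
    ext1 m l
    rw [RingHom.mapMatrix_apply, RingHom.mapMatrix_apply, Matrix.map_apply, Matrix.map_apply]
    simp only [Matrix.mul_apply, Matrix.transpose_apply]
    simp [Φ, M, logHessian]
  have h' := congrArg Φ h
  rw [RingHom.map_det, hM, ← RingHom.map_det, map_zero] at h'
  exact det_transpose_mul_self_ne_zero M hspan (by simpa using h')

theorem Subalgebra.injective_aeval_of_algebraicIndependent_coe {R B ι : Type*} [CommRing R]
    [CommRing B] [Algebra R B] (T : Subalgebra R B) (g : ι → T)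
    (hg : AlgebraicIndependent R fun l => (g l : B)) :
    Function.Injective (aeval g : MvPolynomial ι R →ₐ[R] T) :=
  AlgebraicIndependent.of_comp T.val hg

/-- the `S₀`-algebra map `γ : S = S₀[y_1,…,y_k] → T = S₀[x^{a_1},…,x^{a_d}]`,
`y_l ↦ x_l ∂f/∂x_l`, is injective; here `S₀ = ℂ[α_1,…,α_d]_{E_A}` is the localization at the
principal `A`-determinant, pinned down by its zero locus `V(E_A)`. -/
theorem gamma_injective (d n k : ℕ) (hdn : n < d) (hk : k = d - n)
    (A : Fin d → Fin k → ℤ)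
    (hspan : Submodule.span ℝ (Set.range fun i => fun j => (A i j : ℝ)) = ⊤)
    (hlast : ∀ i, A i ⟨k - 1, by omega⟩ = 1)
    (E : MvPolynomial (Fin d) ℂ)
    (hE : {α : Fin d → ℂ | eval α E = 0} = VEA A) :
    Function.Injective
      (MvPolynomial.aeval (gElemLoc A E) :
        MvPolynomial (Fin k) (Localization.Away E) →ₐ[Localization.Away E] ↥(Tring A E)) := by
  by_cases hE0 : E = 0
  · have : Subsingleton (Localization.Away E) :=
      IsLocalization.subsingleton (M := Submonoid.powers E) ⟨1, by simp [hE0]⟩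
    exact Function.injective_of_subsingleton _
  have hpow : Submonoid.powers E ≤ nonZeroDivisors (MvPolynomial (Fin d) ℂ) :=
    powers_le_nonZeroDivisors_of_noZeroDivisors hE0
  have hinj : Function.Injective (algebraMap (MvPolynomial (Fin d) ℂ) (Localization.Away E)) :=
    IsLocalization.injective _ hpow
  have : IsDomain (Localization.Away E) := IsLocalization.isDomain_localization hpow
  have : CharZero (Localization.Away E) := charZero_of_injective_algebraMap hinj
  have : IsDomain (AddMonoidAlgebra (Localization.Away E) (Fin k → ℤ)) :=
    NoZeroDivisors.to_isDomain _
  have hindep : AlgebraicIndependent (Localization.Away E)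
      fun l => (gElemLoc A E l : AddMonoidAlgebra (Localization.Away E) (Fin k → ℤ)) := by
    refine algebraicIndependent_of_det_derivation_ne_zero (fun m =>
      AddMonoidAlgebra.weightDerivation
        ((Int.castAddHom _).comp (Pi.evalAddMonoidHom (fun _ : Fin k => ℤ) m))) _ ?_
    have hJ := logHessian_map (algebraMap (MvPolynomial (Fin d) ℂ) (Localization.Away E)) A X
    have hdet : (logHessian A (alphaBar E)).det ≠ 0 := by
      unfold alphaBar
      rw [← hJ, ← RingHom.map_det]
      refine (map_ne_zero_iff _ ?_).2 (det_logHessian_X_ne_zero A hspan)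
      exact AddMonoidAlgebra.map_injective _ hinj
    convert hdet using 2
    ext1 m l
    simp [logHessian, gElemLoc, AddMonoidAlgebra.of']
  exact (Tring A E).injective_aeval_of_algebraicIndependent_coe _ hindep

end
end
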